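/- Under the stated limit assumptions, u_∞ = e^{2/(α+2)}; moreover α = 2 + 4√e/t̄, where t̄ is the unique positive root of 2√e·log t + t = 0. -/

import Mathlib

open Real MeasureTheory Set Filter

noncomputable section

/-- The radial energy functional for the Lane–Emden problem on the unit ball of `ℝ²`
(written in polar coordinates; the common factor `2π` is dropped). -/
def radialEnergy (p : ℝ) (v : ℝ → ℝ) : ℝ :=
  (1 / 2) * (∫ r in (0:ℝ)..1, (deriv v r) ^ 2 * r)
    - (1 / (p + 1)) * ∫ r in (0:ℝ)..1, |v r| ^ (p + 1) * r

/-- The Nehari identity `∫_B |∇v⁺|² = ∫_B |v⁺|^{p+1}` for the positive part,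
written in polar coordinates. -/
def nehariPos (p : ℝ) (v : ℝ → ℝ) : Prop :=
  (∫ r in (0:ℝ)..1, (if 0 < v r then (deriv v r) ^ 2 * r else 0))
    = ∫ r in (0:ℝ)..1, (max (v r) 0) ^ (p + 1) * r

/-- The Nehari identity `∫_B |∇v⁻|² = ∫_B |v⁻|^{p+1}` for the negative part,
written in polar coordinates. -/
def nehariNeg (p : ℝ) (v : ℝ → ℝ) : Prop :=
  (∫ r in (0:ℝ)..1, (if v r < 0 then (deriv v r) ^ 2 * r else 0))
    = ∫ r in (0:ℝ)..1, (max (-v r) 0) ^ (p + 1) * r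

/-- A family `p ↦ u p` (for `p > 1`) of least energy nodal radial solutions of the
Lane–Emden problem `−Δu = |u|^{p−1}u` in the unit ball `B ⊆ ℝ²`, `u = 0` on `∂B`,
described through the radial profile `u p : ℝ → ℝ`.  `rp p ∈ (0,1)` is the nodal
radius, `sp p ∈ (rp p, 1)` is a radius where `u p` attains `‖(u p)⁺‖_∞`; the solution
is negative in the inner nodal region (`u p 0 < 0`), attains `-‖(u p)⁻‖_∞` at `0`,
and minimizes the energy among radial members of the nodal Nehari set. -/
structure LaneEmdenFamily where
  u : ℝ → ℝ → ℝ
  rp : ℝ → ℝ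
  sp : ℝ → ℝ
  smooth : ∀ p, 1 < p → ContDiffOn ℝ 2 (u p) (Icc (0:ℝ) 1)
  ode : ∀ p, 1 < p → ∀ r ∈ Ioo (0:ℝ) 1,
    -deriv (deriv (u p)) r - deriv (u p) r / r = |u p r| ^ (p - 1) * u p r
  derivAtZero : ∀ p, 1 < p → deriv (u p) 0 = 0
  boundary : ∀ p, 1 < p → u p 1 = 0
  center_neg : ∀ p, 1 < p → u p 0 < 0
  min_at_zero : ∀ p, 1 < p → ∀ r ∈ Icc (0:ℝ) 1, u p 0 ≤ u p r
  rp_mem : ∀ p, 1 < p → rp p ∈ Ioo (0:ℝ) 1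
  rp_zero : ∀ p, 1 < p → u p (rp p) = 0
  neg_in : ∀ p, 1 < p → ∀ r ∈ Ico (0:ℝ) (rp p), u p r < 0
  pos_out : ∀ p, 1 < p → ∀ r ∈ Ioo (rp p) 1, 0 < u p r
  sp_mem : ∀ p, 1 < p → sp p ∈ Ioo (rp p) 1
  sp_max : ∀ p, 1 < p → ∀ r ∈ Icc (0:ℝ) 1, u p r ≤ u p (sp p)
  least_energy : ∀ p, 1 < p → ∀ v : ℝ → ℝ,
    ContDiffOn ℝ 1 v (Icc (0:ℝ) 1) → v 1 = 0 →
    (∃ r ∈ Ioo (0:ℝ) 1, 0 < v r) → (∃ r ∈ Ioo (0:ℝ) 1, v r < 0) →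
    nehariPos p v → nehariNeg p v →
    radialEnergy p (u p) ≤ radialEnergy p v

/-- `ε_p⁺`, defined by `(ε_p⁺)⁻² = p · ‖u_p⁺‖_∞^{p−1} = p · u_p(s_p)^{p−1}`. -/
def epsP (F : LaneEmdenFamily) (p : ℝ) : ℝ :=
  1 / Real.sqrt (p * F.u p (F.sp p) ^ (p - 1))

/-- `ε_p⁻`, defined by `(ε_p⁻)⁻² = p · ‖u_p⁻‖_∞^{p−1} = p · |u_p(0)|^{p−1}`. -/
def epsM (F : LaneEmdenFamily) (p : ℝ) : ℝ :=
  1 / Real.sqrt (p * (-F.u p 0) ^ (p - 1))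

/-- `α = √(2l² + 4)`. -/
def alphaOf (l : ℝ) : ℝ := Real.sqrt (2 * l ^ 2 + 4)

/-- `β = ((α+2)/(α−2))^{1/α} · l`. -/
def betaOf (l : ℝ) : ℝ := ((alphaOf l + 2) / (alphaOf l - 2)) ^ (1 / alphaOf l) * l

/-- The singular Liouville profile `Z_l(r) = log(2α²β^α r^{α−2}/(β^α + r^α)²)`. -/
def Zl (l : ℝ) (r : ℝ) : ℝ :=
  Real.log (2 * alphaOf l ^ 2 * betaOf l ^ alphaOf l * r ^ (alphaOf l - 2)
    / (betaOf l ^ alphaOf l + r ^ alphaOf l) ^ 2)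

lemma le_of_hasDerivAt_nonneg {f f' : ℝ → ℝ} {a b : ℝ} (hab : a ≤ b)
    (hc : ContinuousOn f (Icc a b)) (hd : ∀ t ∈ Ioo a b, HasDerivAt f (f' t) t)
    (h0 : ∀ t ∈ Ioo a b, 0 ≤ f' t) : f a ≤ f b := by
  refine monotoneOn_of_deriv_nonneg (convex_Icc a b) hc ?_ ?_
    (left_mem_Icc.2 hab) (right_mem_Icc.2 hab) hab
  · intro t ht
    rw [interior_Icc] at ht
    exact (hd t ht).differentiableAt.differentiableWithinAt
  · intro t ht
    rw [interior_Icc] at ht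
    rw [(hd t ht).deriv]
    exact h0 t ht

lemma le_of_hasDerivAt_nonpos {f f' : ℝ → ℝ} {a b : ℝ} (hab : a ≤ b)
    (hc : ContinuousOn f (Icc a b)) (hd : ∀ t ∈ Ioo a b, HasDerivAt f (f' t) t)
    (h0 : ∀ t ∈ Ioo a b, f' t ≤ 0) : f b ≤ f a := by
  have := le_of_hasDerivAt_nonneg (f := fun t => -f t) (f' := fun t => -f' t) hab hc.neg
    (fun t ht => (hd t ht).neg) (fun t ht => by linarith [h0 t ht])
  linarith

lemma le_of_hasDerivAt_nonneg_of_tendsto_atBot {f f' : ℝ → ℝ} {b L : ℝ}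
    (hd : ∀ t ∈ Iio b, HasDerivAt f (f' t) t) (h0 : ∀ t ∈ Iio b, 0 ≤ f' t)
    (hL : Tendsto f atBot (nhds L)) {t : ℝ} (ht : t < b) : L ≤ f t := by
  refine le_of_tendsto hL ?_
  filter_upwards [eventually_le_atBot t] with s hs
  refine le_of_hasDerivAt_nonneg hs (fun x hx => ?_) (fun x hx => hd x ?_) (fun x hx => h0 x ?_)
  · exact (hd x (lt_of_le_of_lt hx.2 ht)).continuousAt.continuousWithinAt
  · exact hx.2.trans ht
  · exact hx.2.trans ht

lemma le_of_hasDerivAt_nonpos_of_tendsto_atBot {f f' : ℝ → ℝ} {b L : ℝ}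
    (hd : ∀ t ∈ Iio b, HasDerivAt f (f' t) t) (h0 : ∀ t ∈ Iio b, f' t ≤ 0)
    (hL : Tendsto f atBot (nhds L)) {t : ℝ} (ht : t < b) : f t ≤ L := by
  have := le_of_hasDerivAt_nonneg_of_tendsto_atBot (f := fun t => -f t) (f' := fun t => -f' t)
    (fun t ht => (hd t ht).neg) (fun t ht => by linarith [h0 t ht]) hL.neg ht
  linarith

/-- The Lane–Emden equation in the logarithmic variable `t = log r`, for the normalized positive
profile `m = u / M` and its scaled slope `X = p r u' / M`, where `exp (-2 c) = p M ^ (p - 1)`. -/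
structure EmdenSystem (p c : ℝ) (S : Set ℝ) (m X : ℝ → ℝ) : Prop where
  deriv_m : ∀ t ∈ S, HasDerivAt m (X t / p) t
  deriv_X : ∀ t ∈ S, HasDerivAt X (-(exp (2 * (t - c)) * m t ^ p)) t
  pos : ∀ t ∈ S, 0 < m t
  le_one : ∀ t ∈ S, m t ≤ 1

/-- The mass density `q = exp (2 (t - c)) m ^ p`. -/
def emdenMass (p c : ℝ) (m : ℝ → ℝ) (t : ℝ) : ℝ := exp (2 * (t - c)) * m t ^ p

/-- The energy of the limiting Liouville system. -/
def liouvilleEnergy (p c : ℝ) (m X : ℝ → ℝ) (t : ℝ) : ℝ :=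
  X t ^ 2 / 2 + 2 * X t + emdenMass p c m t

/-- The Pohozaev functional of the system. -/
def pohozaev (p c : ℝ) (m X : ℝ → ℝ) (t : ℝ) : ℝ :=
  X t ^ 2 / 2 + 2 * X t + p / (p + 1) * (emdenMass p c m t * m t)

lemma hasDerivAt_exp_two_mul_sub (c t : ℝ) :
    HasDerivAt (fun t => exp (2 * (t - c))) (2 * exp (2 * (t - c))) t := by
  have h := (((hasDerivAt_id t).sub_const c).const_mul 2).exp
  simp only [id] at h
  convert h using 1
  ring

namespace EmdenSystem

variable {p c : ℝ} {S : Set ℝ} {m X : ℝ → ℝ}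

lemma mass_pos (h : EmdenSystem p c S m X) {t : ℝ} (ht : t ∈ S) : 0 < emdenMass p c m t :=
  mul_pos (exp_pos _) (rpow_pos_of_pos (h.pos t ht) p)

lemma mass_le (h : EmdenSystem p c S m X) (hp : 1 < p) {t : ℝ} (ht : t ∈ S) :
    emdenMass p c m t ≤ exp (2 * (t - c)) :=
  mul_le_of_le_one_right (exp_pos _).le
    (rpow_le_one (h.pos t ht).le (h.le_one t ht) (by linarith))

lemma hasDerivAt_mass (h : EmdenSystem p c S m X) (hp : 1 < p) {t : ℝ} (ht : t ∈ S) :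
    HasDerivAt (emdenMass p c m) (emdenMass p c m t * (2 + X t / m t)) t := by
  have hm := h.pos t ht
  have h2 := (h.deriv_m t ht).rpow_const (p := p) (Or.inl hm.ne')
  refine ((hasDerivAt_exp_two_mul_sub c t).mul h2).congr_deriv ?_
  rw [rpow_sub_one hm.ne', emdenMass]
  field_simp

lemma hasDerivAt_liouvilleEnergy (h : EmdenSystem p c S m X) (hp : 1 < p) {t : ℝ}
    (ht : t ∈ S) :
    HasDerivAt (liouvilleEnergy p c m X) (emdenMass p c m t * X t * (1 / m t - 1)) t := by
  have hX := h.deriv_X t ht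
  refine ((((hX.pow 2).div_const 2).add (hX.const_mul 2)).add
    (h.hasDerivAt_mass hp ht)).congr_deriv ?_
  rw [← emdenMass]
  push_cast
  ring

lemma hasDerivAt_pohozaev (h : EmdenSystem p c S m X) (hp : 1 < p) {t : ℝ} (ht : t ∈ S) :
    HasDerivAt (pohozaev p c m X) (-2 * emdenMass p c m t * (1 - p / (p + 1) * m t)) t := by
  have hX := h.deriv_X t ht
  have hm := h.pos t ht
  refine ((((hX.pow 2).div_const 2).add (hX.const_mul 2)).add
    (((h.hasDerivAt_mass hp ht).mul (h.deriv_m t ht)).const_mul (p / (p + 1)))).congr_deriv ?_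
  rw [← emdenMass]
  field_simp
  push_cast
  ring

lemma continuousOn_liouvilleEnergy {s : Set ℝ} (hp : 1 < p) (hm : ContinuousOn m s)
    (hX : ContinuousOn X s) : ContinuousOn (liouvilleEnergy p c m X) s := by
  have hq : ContinuousOn (fun t => m t ^ p) s := hm.rpow_const fun _ _ => Or.inr (by linarith)
  unfold liouvilleEnergy emdenMass
  fun_prop

lemma continuousOn_pohozaev {s : Set ℝ} (hp : 1 < p) (hm : ContinuousOn m s)
    (hX : ContinuousOn X s) : ContinuousOn (pohozaev p c m X) s := by
  have hq : ContinuousOn (fun t => m t ^ p) s := hm.rpow_const fun _ _ => Or.inr (by linarith)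
  unfold pohozaev emdenMass
  fun_prop

lemma pohozaev_le (h : EmdenSystem p c S m X) (hp : 1 < p) {t : ℝ} (ht : t ∈ S) :
    pohozaev p c m X t ≤ liouvilleEnergy p c m X t := by
  have h1 : p / (p + 1) ≤ 1 := by rw [div_le_one (by linarith)]; linarith
  have h2 : p / (p + 1) * m t ≤ 1 :=
    mul_le_one₀ h1 (h.pos t ht).le (h.le_one t ht)
  have := mul_le_mul_of_nonneg_left h2 (h.mass_pos ht).le
  unfold pohozaev liouvilleEnergy
  linarith

lemma antitone_slope (h : EmdenSystem p c S m X) {a b : ℝ} (hab : a ≤ b)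
    (hS : Ioo a b ⊆ S) (hX : ContinuousOn X (Icc a b)) : X b ≤ X a :=
  le_of_hasDerivAt_nonpos hab hX (fun t ht => h.deriv_X t (hS ht))
    (fun t ht => by have := h.mass_pos (hS ht); unfold emdenMass at this; linarith)

lemma continuousOn_slope (h : EmdenSystem p c S m X) {s : Set ℝ} (hs : s ⊆ S) :
    ContinuousOn X s :=
  fun t ht => (h.deriv_X t (hs ht)).continuousAt.continuousWithinAt

lemma continuousOn_profile (h : EmdenSystem p c S m X) {s : Set ℝ} (hs : s ⊆ S) :
    ContinuousOn m s :=
  fun t ht => (h.deriv_m t (hs ht)).continuousAt.continuousWithinAt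

/-- If the slope is at most `k` on an interval, the profile grows at most linearly. -/
lemma profile_le (h : EmdenSystem p c S m X) (hp : 1 < p) {a b k : ℝ} (hab : a ≤ b)
    (hS : Ioo a b ⊆ S) (hm : ContinuousOn m (Icc a b)) (hk : ∀ t ∈ Ioo a b, X t ≤ k) :
    p * m b ≤ p * m a + k * (b - a) := by
  have := le_of_hasDerivAt_nonpos (f := fun t => p * m t - k * t) (f' := fun t => X t - k) hab
    (by fun_prop) (fun t ht => ?_) (fun t ht => by linarith [hk t ht])
  · linarith
  · refine (((h.deriv_m t (hS ht)).const_mul p).sub ((hasDerivAt_id t).const_mul k)).congr_deriv ?_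
    field_simp

/-- If the slope is at least `k` on an interval, the profile grows at least linearly. -/
lemma le_profile (h : EmdenSystem p c S m X) (hp : 1 < p) {a b k : ℝ} (hab : a ≤ b)
    (hS : Ioo a b ⊆ S) (hm : ContinuousOn m (Icc a b)) (hk : ∀ t ∈ Ioo a b, k ≤ X t) :
    p * m a + k * (b - a) ≤ p * m b := by
  have := le_of_hasDerivAt_nonneg (f := fun t => p * m t - k * t) (f' := fun t => X t - k) hab
    (by fun_prop) (fun t ht => ?_) (fun t ht => by linarith [hk t ht])
  · linarith
  · refine (((h.deriv_m t (hS ht)).const_mul p).sub ((hasDerivAt_id t).const_mul k)).congr_deriv ?_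
    field_simp

/-- If the Pohozaev functional stays near the level `(a² - 4) / 2` for a long enough time, the
slope gets close to its terminal value `-(a + 2)`. -/
lemma slope_le_of_pohozaev (h : EmdenSystem p c S m X) (hp : 1 < p) {t₀ K a g δ η : ℝ}
    (hK : 0 ≤ K) (hS : Icc t₀ (t₀ + K) ⊆ S) (hg : 0 < g) (hδ : 0 < δ)
    (h0 : X t₀ ≤ 0) (hgap : X t₀ + g ≤ a - 2)
    (hQ : ∀ t ∈ Icc t₀ (t₀ + K), (a ^ 2 - 4) / 2 - η ≤ pohozaev p c m X t)
    (hη : η ≤ δ * g / 4) (hKδ : a + 2 ≤ K * (δ * g / 4)) :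
    X (t₀ + K) ≤ -(a + 2) + δ := by
  by_contra! hcon
  have hle : t₀ ≤ t₀ + K := by linarith
  have hanti : ∀ s ∈ Icc t₀ (t₀ + K), ∀ t ∈ Icc t₀ (t₀ + K), s ≤ t → X t ≤ X s := by
    intro s hs t ht hst
    have hsub : Icc s t ⊆ S := (Icc_subset_Icc hs.1 ht.2).trans hS
    exact h.antitone_slope hst (Ioo_subset_Icc_self.trans hsub) (h.continuousOn_slope hsub)
  have hq : ∀ t ∈ Icc t₀ (t₀ + K), δ * g / 4 ≤ emdenMass p c m t := by
    intro t ht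
    have h1 := hanti t₀ (left_mem_Icc.2 hle) t ht ht.1
    have h2 := hanti t ht _ (right_mem_Icc.2 hle) ht.2
    have h3 := (hQ t ht).trans (h.pohozaev_le hp (hS ht))
    have h4 : g * δ ≤ (a - 2 - X t) * (X t + a + 2) :=
      mul_le_mul (by linarith) (by linarith) hδ.le (by linarith)
    unfold liouvilleEnergy at h3
    nlinarith
  have := le_of_hasDerivAt_nonpos (f := fun t => X t + δ * g / 4 * t)
    (f' := fun t => -emdenMass p c m t + δ * g / 4) hle
    ((h.continuousOn_slope hS).add (by fun_prop))
    (fun t ht => ?_) (fun t ht => by linarith [hq t (Ioo_subset_Icc_self ht)])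
  · nlinarith
  · refine ((h.deriv_X t (hS (Ioo_subset_Icc_self ht))).add
      ((hasDerivAt_id t).const_mul _)).congr_deriv ?_
    simp [emdenMass]

end EmdenSystem

namespace EmdenSystem

variable {p c : ℝ} {S : Set ℝ} {m X : ℝ → ℝ}

lemma hasDerivAt_pohozaev_sub (h : EmdenSystem p c S m X) (hp : 1 < p) {t : ℝ} (ht : t ∈ S)
    (k : ℝ) :
    HasDerivAt (fun t => pohozaev p c m X t - 2 * k * X t)
      (2 * emdenMass p c m t * (k - (1 - p / (p + 1) * m t))) t := by
  refine ((h.hasDerivAt_pohozaev hp ht).sub ((h.deriv_X t ht).const_mul (2 * k))).congr_deriv ?_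
  rw [← emdenMass]
  ring

lemma deriv_pohozaev_sub_nonneg (h : EmdenSystem p c S m X) (hp : 1 < p) {t d : ℝ} (ht : t ∈ S)
    (hd : 1 - d ≤ m t) :
    0 ≤ 2 * emdenMass p c m t * (d + 1 / p - (1 - p / (p + 1) * m t)) := by
  have hq := h.mass_pos ht
  have hp0 : 0 < p := by linarith
  have h1 : p / (p + 1) * m t = m t - m t / (p + 1) := by field_simp; ring
  have h2 : m t / (p + 1) ≤ 1 / p :=
    div_le_div₀ zero_le_one (h.le_one t ht) hp0 (by linarith)
  exact mul_nonneg (by positivity) (by linarith)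

lemma time_le (h : EmdenSystem p c S m X) (hp : 1 < p) {s K b k : ℝ} (hK : 0 ≤ K)
    (hb : s + K < b) (hS : Ico s b ⊆ S) (hm : ContinuousOn m (Icc s b)) (hmb : m b = 0)
    (hk : X (s + K) ≤ -k) : k * (b - s - K) ≤ p := by
  have hsub : Ico (s + K) b ⊆ S := (Ico_subset_Ico_left (by linarith)).trans hS
  have h1 : m (s + K) ≤ 1 := h.le_one _ (hS ⟨by linarith, hb⟩)
  have h2 := h.profile_le hp (a := s + K) (b := b) (k := -k) hb.le
    (Ioo_subset_Ico_self.trans hsub) (hm.mono (Icc_subset_Icc_left (by linarith))) ?_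
  · rw [hmb] at h2
    nlinarith
  · intro t ht
    refine le_trans (h.antitone_slope ht.1.le ?_ (h.continuousOn_slope ?_)) hk
    · exact fun x hx => hsub ⟨hx.1.le, hx.2.trans ht.2⟩
    · exact fun x hx => hsub ⟨hx.1, hx.2.trans_lt ht.2⟩

section Maximum

variable {a s b : ℝ}

lemma liouvilleEnergy_max (hX : X s = 0) (hm : m s = 1) :
    liouvilleEnergy p c m X s = exp (2 * (s - c)) := by
  simp [liouvilleEnergy, emdenMass, hX, hm]

lemma pohozaev_max (hX : X s = 0) (hm : m s = 1) :
    pohozaev p c m X s = p / (p + 1) * exp (2 * (s - c)) := by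
  simp [pohozaev, emdenMass, hX, hm]

lemma slope_nonpos (h : EmdenSystem p c S m X) (hS : Ico s b ⊆ S) (hX : X s = 0) {t : ℝ}
    (ht : t ∈ Ico s b) : X t ≤ 0 := by
  have hsub : Icc s t ⊆ S := fun x hx => hS ⟨hx.1, hx.2.trans_lt ht.2⟩
  rw [← hX]
  exact h.antitone_slope ht.1 (Ioo_subset_Icc_self.trans hsub) (h.continuousOn_slope hsub)

lemma neg_le_slope (h : EmdenSystem p c S m X) (hp : 1 < p) (hS : Ico s b ⊆ S) (hX : X s = 0)
    (hm : m s = 1) {t : ℝ} (ht : t ∈ Ico s b) :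
    -(√(4 + 2 * exp (2 * (s - c))) + 2) ≤ X t := by
  have hsub : Icc s t ⊆ S := fun x hx => hS ⟨hx.1, hx.2.trans_lt ht.2⟩
  have h1 := le_of_hasDerivAt_nonpos ht.1
    (continuousOn_liouvilleEnergy (c := c) hp (h.continuousOn_profile hsub)
      (h.continuousOn_slope hsub))
    (fun x hx => h.hasDerivAt_liouvilleEnergy hp (hsub (Ioo_subset_Icc_self hx)))
    (fun x hx => ?_)
  · rw [liouvilleEnergy_max hX hm, liouvilleEnergy] at h1
    have hq := h.mass_pos (hS ht)
    have h2 : (X t + 2) ^ 2 ≤ 4 + 2 * exp (2 * (s - c)) := by nlinarith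
    have := (abs_le.1 (abs_le_sqrt h2)).1
    linarith
  · have hxS := hsub (Ioo_subset_Icc_self hx)
    have hq := h.mass_pos hxS
    have h3 : 1 ≤ 1 / m x := by
      rw [le_div_iff₀ (h.pos x hxS)]; linarith [h.le_one x hxS]
    have h4 := h.slope_nonpos hS hX ⟨hx.1.le, hx.2.trans ht.2⟩
    exact mul_nonpos_of_nonpos_of_nonneg (mul_nonpos_of_nonneg_of_nonpos hq.le h4)
      (by linarith)

lemma le_profile_max (h : EmdenSystem p c S m X) (hp : 1 < p) (hS : Ico s b ⊆ S) (hX : X s = 0)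
    (hm : m s = 1) (hmc : ContinuousOn m (Icc s b)) {t : ℝ} (ht : t ∈ Icc s b) :
    p - (√(4 + 2 * exp (2 * (s - c))) + 2) * (t - s) ≤ p * m t := by
  have hsub : Ioo s t ⊆ Ico s b := fun x hx => ⟨hx.1.le, hx.2.trans_le ht.2⟩
  have := h.le_profile hp ht.1 (hsub.trans hS) (hmc.mono (Icc_subset_Icc_right ht.2))
    (fun x hx => h.neg_le_slope hp hS hX hm (hsub hx))
  rw [hm] at this
  linarith

lemma le_pohozaev_max (h : EmdenSystem p c S m X) (hp : 1 < p) (hS : Ico s b ⊆ S) (hX : X s = 0)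
    (hm : m s = 1) (hmc : ContinuousOn m (Icc s b)) {K t : ℝ} (hK : s + K < b)
    (ht : t ∈ Icc s (s + K)) :
    p / (p + 1) * exp (2 * (s - c))
      - 2 * (((√(4 + 2 * exp (2 * (s - c))) + 2) * K + 1) / p)
        * (√(4 + 2 * exp (2 * (s - c))) + 2) ≤ pohozaev p c m X t := by
  set A := √(4 + 2 * exp (2 * (s - c))) + 2 with hA
  have hA0 : 0 ≤ A := by positivity
  have hp0 : 0 < p := by linarith
  have hsub : Icc s t ⊆ S := fun x hx => hS ⟨hx.1, by linarith [hx.2, ht.2]⟩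
  have hk : A * K / p + 1 / p = (A * K + 1) / p := by ring
  have h1 := le_of_hasDerivAt_nonneg
    (f := fun t => pohozaev p c m X t - 2 * (A * K / p + 1 / p) * X t) ht.1
    ((continuousOn_pohozaev (c := c) hp (h.continuousOn_profile hsub)
      (h.continuousOn_slope hsub)).sub
      ((h.continuousOn_slope hsub).const_smul (2 * (A * K / p + 1 / p))))
    (fun x hx => h.hasDerivAt_pohozaev_sub hp (hsub (Ioo_subset_Icc_self hx)) _)
    (fun x hx => h.deriv_pohozaev_sub_nonneg hp (hsub (Ioo_subset_Icc_self hx)) ?_)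
  · simp only [pohozaev_max hX hm, hX, hk] at h1
    have h2 := h.neg_le_slope hp hS hX hm (t := t) ⟨ht.1, by linarith [ht.2]⟩
    have h3 : 0 ≤ (A * K + 1) / p :=
      div_nonneg (by nlinarith [ht.1, ht.2]) hp0.le
    nlinarith
  · have h4 := h.le_profile_max hp hS hX hm hmc (t := x) ⟨hx.1.le, by linarith [hx.2, ht.2]⟩
    rw [← hA] at h4
    have h5 : A * (x - s) ≤ A * K :=
      mul_le_mul_of_nonneg_left (by linarith [hx.2, ht.2]) hA0
    rw [sub_le_iff_le_add, ← sub_le_iff_le_add', le_div_iff₀ hp0]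
    linarith

lemma le_time_max (h : EmdenSystem p c S m X) (hp : 1 < p) (hsb : s ≤ b) (hS : Ico s b ⊆ S)
    (hX : X s = 0) (hm : m s = 1) (hmc : ContinuousOn m (Icc s b)) (hmb : m b = 0) :
    p ≤ (√(4 + 2 * exp (2 * (s - c))) + 2) * (b - s) := by
  have := h.le_profile_max hp hS hX hm hmc (right_mem_Icc.2 hsb)
  rw [hmb] at this
  linarith

lemma liouvilleEnergy_left (h : EmdenSystem p c S m X) (hp : 1 < p) (has : a ≤ s)
    (hS : Ioc a s ⊆ S) (hmc : ContinuousOn m (Icc a s)) (hXc : ContinuousOn X (Icc a s))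
    (hX : X s = 0) (hm : m s = 1) (hma : m a = 0) :
    X a ^ 2 / 2 + 2 * X a ≤ exp (2 * (s - c)) := by
  have h1 := le_of_hasDerivAt_nonneg has (continuousOn_liouvilleEnergy (c := c) hp hmc hXc)
    (fun x hx => h.hasDerivAt_liouvilleEnergy hp (hS (Ioo_subset_Ioc_self hx)))
    (fun x hx => ?_)
  · rw [liouvilleEnergy_max hX hm] at h1
    simpa [liouvilleEnergy, emdenMass, hma, zero_rpow (by linarith : p ≠ 0)] using h1
  · have hxS := hS (Ioo_subset_Ioc_self hx)
    have hq := h.mass_pos hxS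
    have h3 : 1 ≤ 1 / m x := by
      rw [le_div_iff₀ (h.pos x hxS)]; linarith [h.le_one x hxS]
    have h4 : X s ≤ X x := h.antitone_slope hx.2.le
      (fun y hy => hS ⟨hx.1.trans hy.1, hy.2.le⟩) (hXc.mono (Icc_subset_Icc_left hx.1.le))
    rw [hX] at h4
    exact mul_nonneg (mul_nonneg hq.le h4) (by linarith)

lemma pohozaev_left (h : EmdenSystem p c S m X) (hp : 1 < p) (has : a ≤ s)
    (hS : Ioc a s ⊆ S) (hmc : ContinuousOn m (Icc a s)) (hXc : ContinuousOn X (Icc a s))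
    (hX : X s = 0) (hm : m s = 1) (hma : m a = 0) :
    p / (p + 1) * exp (2 * (s - c)) ≤ X a ^ 2 / 2 + 2 * X a := by
  have h1 := le_of_hasDerivAt_nonpos has (continuousOn_pohozaev (c := c) hp hmc hXc)
    (fun x hx => h.hasDerivAt_pohozaev hp (hS (Ioo_subset_Ioc_self hx)))
    (fun x hx => ?_)
  · rw [pohozaev_max hX hm] at h1
    simpa [pohozaev, emdenMass, hma, zero_rpow (by linarith : p ≠ 0)] using h1
  · have hxS := hS (Ioo_subset_Ioc_self hx)
    have hq := h.mass_pos hxS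
    have h2 : p / (p + 1) ≤ 1 := by rw [div_le_one (by linarith)]; linarith
    have h3 : p / (p + 1) * m x ≤ 1 := mul_le_one₀ h2 (h.pos x hxS).le (h.le_one x hxS)
    nlinarith

lemma slope_left_nonneg (h : EmdenSystem p c S m X) (has : a ≤ s)
    (hS : Ioc a s ⊆ S) (hXc : ContinuousOn X (Icc a s)) (hX : X s = 0) : 0 ≤ X a := by
  rw [← hX]
  exact h.antitone_slope has (Ioo_subset_Ioc_self.trans hS) hXc

lemma le_time_left (h : EmdenSystem p c S m X) (hp : 1 < p) (has : a ≤ s)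
    (hS : Ioc a s ⊆ S) (hmc : ContinuousOn m (Icc a s)) (hXc : ContinuousOn X (Icc a s))
    (hm : m s = 1) (hma : m a = 0) : p ≤ X a * (s - a) := by
  have := h.profile_le hp has (Ioo_subset_Ioc_self.trans hS) hmc (k := X a) fun t ht =>
    h.antitone_slope ht.1.le (fun x hx => hS ⟨hx.1, hx.2.le.trans ht.2.le⟩)
      (hXc.mono (Icc_subset_Icc_right ht.2.le))
  rw [hm, hma] at this
  linarith

lemma time_left_le (h : EmdenSystem p c S m X) (hp : 1 < p) (has : a ≤ s)
    (hS : Ioc a s ⊆ S) (hmc : ContinuousOn m (Icc a s)) (hXc : ContinuousOn X (Icc a s))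
    (hm : m s = 1) (hma : m a = 0) :
    X a * (s - a) ≤ p + exp (2 * (s - c)) / 4 := by
  have hp0 : p ≠ 0 := by linarith
  have hslope : ∀ t ∈ Ioo a s, X a ≤ X t + exp (2 * (t - c)) / 2 := by
    intro t ht
    have h1 := le_of_hasDerivAt_nonneg (f := fun t => X t + exp (2 * (t - c)) / 2) ht.1.le
      ((hXc.mono (Icc_subset_Icc_right ht.2.le)).add (by fun_prop))
      (fun x hx => (h.deriv_X x (hS ⟨hx.1, hx.2.le.trans ht.2.le⟩)).add
        ((hasDerivAt_exp_two_mul_sub c x).div_const 2)) (fun x hx => ?_)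
    · have := exp_pos (2 * (a - c))
      linarith
    · have := h.mass_le hp (hS ⟨hx.1, hx.2.le.trans ht.2.le⟩)
      rw [emdenMass] at this
      linarith
  have h2 := le_of_hasDerivAt_nonneg
    (f := fun t => p * m t - X a * t + exp (2 * (t - c)) / 4) has
    (by fun_prop)
    (fun x hx => (((h.deriv_m x (hS ⟨hx.1, hx.2.le⟩)).const_mul p).sub
      ((hasDerivAt_id x).const_mul (X a))).add ((hasDerivAt_exp_two_mul_sub c x).div_const 4))
    (fun x hx => ?_)
  · simp only [hm, hma] at h2
    have := exp_pos (2 * (a - c))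
    linarith
  · have := hslope x hx
    have h3 : p * (X x / p) = X x := by field_simp
    linarith

end Maximum

section Center

variable {b : ℝ}

lemma tendsto_exp_atBot (c : ℝ) : Tendsto (fun t : ℝ => exp (2 * (t - c))) atBot (nhds 0) :=
  Real.tendsto_exp_atBot.comp
    ((tendsto_atBot_add_const_right atBot (-c) tendsto_id).const_mul_atBot two_pos)

lemma tendsto_mass (h : EmdenSystem p c (Iio b) m X) (hp : 1 < p) :
    Tendsto (emdenMass p c m) atBot (nhds 0) := by
  refine tendsto_of_tendsto_of_tendsto_of_le_of_le' tendsto_const_nhds (tendsto_exp_atBot c) ?_ ?_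
  · filter_upwards [eventually_lt_atBot b] with t ht using (h.mass_pos ht).le
  · filter_upwards [eventually_lt_atBot b] with t ht using h.mass_le hp ht

lemma slope_nonpos_center (h : EmdenSystem p c (Iio b) m X)
    (hX : Tendsto X atBot (nhds 0)) {t : ℝ} (ht : t < b) : X t ≤ 0 :=
  le_of_hasDerivAt_nonpos_of_tendsto_atBot h.deriv_X
    (fun _ hx => neg_nonpos.2 (h.mass_pos hx).le) hX ht

lemma neg_four_le_slope (h : EmdenSystem p c (Iio b) m X) (hp : 1 < p)
    (hX : Tendsto X atBot (nhds 0)) {t : ℝ} (ht : t < b) : -4 ≤ X t := by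
  have hlim : Tendsto (liouvilleEnergy p c m X) atBot (nhds 0) := by
    have := (((hX.pow 2).div_const 2).add (hX.const_mul 2)).add (h.tendsto_mass hp)
    simp only [ne_eq, OfNat.ofNat_ne_zero, not_false_eq_true, zero_pow, zero_div, mul_zero,
      add_zero] at this
    exact this
  have h1 := le_of_hasDerivAt_nonpos_of_tendsto_atBot
    (fun x hx => h.hasDerivAt_liouvilleEnergy hp hx) (fun x hx => ?_) hlim ht
  · have hq := h.mass_pos ht
    rw [liouvilleEnergy] at h1
    nlinarith
  · have hq := h.mass_pos hx
    have h3 : 1 ≤ 1 / m x := by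
      rw [le_div_iff₀ (h.pos x hx)]; linarith [h.le_one x hx]
    exact mul_nonpos_of_nonpos_of_nonneg
      (mul_nonpos_of_nonneg_of_nonpos hq.le (h.slope_nonpos_center hX hx)) (by linarith)

lemma neg_exp_le_slope (h : EmdenSystem p c (Iio b) m X) (hp : 1 < p)
    (hX : Tendsto X atBot (nhds 0)) {t : ℝ} (ht : t < b) : -(exp (2 * (t - c)) / 2) ≤ X t := by
  have hlim : Tendsto (fun t => X t + exp (2 * (t - c)) / 2) atBot (nhds 0) := by
    simpa using hX.add ((tendsto_exp_atBot c).div_const 2)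
  have h1 := le_of_hasDerivAt_nonneg_of_tendsto_atBot
    (fun x hx => (h.deriv_X x hx).add ((hasDerivAt_exp_two_mul_sub c x).div_const 2))
    (fun x hx => ?_) hlim ht
  · simp only [Pi.add_apply] at h1
    linarith
  · have := h.mass_le hp hx
    rw [emdenMass] at this
    linarith

lemma le_profile_center (h : EmdenSystem p c (Iio b) m X) (hp : 1 < p)
    (hX : Tendsto X atBot (nhds 0)) (hm : Tendsto m atBot (nhds 1)) {t : ℝ} (ht : t < b) :
    p - exp (2 * (t - c)) / 4 ≤ p * m t := by
  have hp0 : p ≠ 0 := by linarith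
  have hlim : Tendsto (fun t => p * m t + exp (2 * (t - c)) / 4) atBot (nhds p) := by
    simpa using (hm.const_mul p).add ((tendsto_exp_atBot c).div_const 4)
  have h1 := le_of_hasDerivAt_nonneg_of_tendsto_atBot
    (fun x hx => ((h.deriv_m x hx).const_mul p).add
      ((hasDerivAt_exp_two_mul_sub c x).div_const 4))
    (fun x hx => ?_) hlim ht
  · simp only [Pi.add_apply] at h1
    linarith
  · have := h.neg_exp_le_slope hp hX hx
    have h3 : p * (X x / p) = X x := by field_simp
    linarith

lemma le_exp_center (h : EmdenSystem p c (Iio b) m X) (hp : 1 < p)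
    (hX : Tendsto X atBot (nhds 0)) (hm : Tendsto m atBot (nhds 1))
    (hmb : ContinuousAt m b) (hmb0 : m b = 0) : 4 * p ≤ exp (2 * (b - c)) := by
  have hc : ContinuousAt (fun t => p * m t + exp (2 * (t - c)) / 4) b := by fun_prop
  have h1 : p ≤ p * m b + exp (2 * (b - c)) / 4 := by
    refine ge_of_tendsto (hc.tendsto.mono_left nhdsWithin_le_nhds :
      Tendsto _ (nhdsWithin b (Iio b)) _) ?_
    filter_upwards [self_mem_nhdsWithin] with t ht
    linarith [h.le_profile_center hp hX hm ht]
  rw [hmb0] at h1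
  linarith

lemma slope_center_le (h : EmdenSystem p c (Iio b) m X) (hp : 1 < p)
    (hX : Tendsto X atBot (nhds 0)) (hm : Tendsto m atBot (nhds 1)) (hcb : c < b) :
    X c ≤ -(3 / 8) := by
  have hp0 : 0 < p := by linarith
  have hlim : Tendsto (fun t => X t + 3 / 8 * exp (2 * (t - c))) atBot (nhds 0) := by
    simpa using hX.add ((tendsto_exp_atBot c).const_mul (3 / 8))
  have hmass : ∀ t, t < c → 3 / 4 * exp (2 * (t - c)) ≤ exp (2 * (t - c)) * m t ^ p := by
    intro t ht
    have h1 := h.le_profile_center hp hX hm (ht.trans hcb)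
    have h2 : exp (2 * (t - c)) ≤ 1 := exp_le_one_iff.2 (by linarith)
    have h3 := one_add_mul_self_le_rpow_one_add (s := m t - 1)
      (by linarith [h.pos t (ht.trans hcb)]) hp.le
    rw [add_sub_cancel] at h3
    have h4 : 3 / 4 ≤ m t ^ p := by linarith
    linarith [mul_le_mul_of_nonneg_left h4 (exp_pos (2 * (t - c))).le]
  have h1 : ∀ t, t < c → X t + 3 / 8 * exp (2 * (t - c)) ≤ 0 := fun t ht =>
    le_of_hasDerivAt_nonpos_of_tendsto_atBot
      (fun x hx => (h.deriv_X x (lt_trans hx hcb)).add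
        ((hasDerivAt_exp_two_mul_sub c x).const_mul (3 / 8)))
      (fun x hx => by linarith [hmass x hx]) hlim ht
  have hc : ContinuousAt (fun t => X t + 3 / 8 * exp (2 * (t - c))) c :=
    (h.deriv_X c hcb).continuousAt.add (by fun_prop)
  have h2 : X c + 3 / 8 * exp (2 * (c - c)) ≤ 0 := by
    refine le_of_tendsto (hc.tendsto.mono_left nhdsWithin_le_nhds :
      Tendsto _ (nhdsWithin c (Iio c)) _) ?_
    filter_upwards [self_mem_nhdsWithin] with t ht using h1 t ht
  simp at h2
  linarith

lemma le_profile_after_center (h : EmdenSystem p c (Iio b) m X) (hp : 1 < p)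
    (hX : Tendsto X atBot (nhds 0)) (hm : Tendsto m atBot (nhds 1)) {t : ℝ} (hct : c ≤ t)
    (htb : t < b) : p - 1 / 4 - 4 * (t - c) ≤ p * m t := by
  have h1 := h.le_profile_center hp hX hm (hct.trans_lt htb)
  have hsub : Icc c t ⊆ Iio b := fun x hx => hx.2.trans_lt htb
  have h2 := h.le_profile hp hct (Ioo_subset_Icc_self.trans hsub) (h.continuousOn_profile hsub)
    (k := -4) (fun x hx => h.neg_four_le_slope hp hX (hx.2.trans htb))
  simp at h1
  linarith

lemma le_pohozaev_center (h : EmdenSystem p c (Iio b) m X) (hp : 1 < p)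
    (hX : Tendsto X atBot (nhds 0)) (hm : Tendsto m atBot (nhds 1)) {K t : ℝ} (hK : 0 ≤ K)
    (hcb : c + K < b) (ht : t < c + K) :
    -(8 * ((1 / 4 + 4 * K) / p + 1 / p)) ≤ pohozaev p c m X t := by
  have hp0 : 0 < p := by linarith
  set k := (1 / 4 + 4 * K) / p + 1 / p with hk
  have hlim : Tendsto (fun t => pohozaev p c m X t - 2 * k * X t) atBot (nhds 0) := by
    have := ((((hX.pow 2).div_const 2).add (hX.const_mul 2)).add
      (((h.tendsto_mass hp).mul hm).const_mul (p / (p + 1)))).sub (hX.const_mul (2 * k))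
    simp only [ne_eq, OfNat.ofNat_ne_zero, not_false_eq_true, zero_pow, zero_div, mul_zero,
      zero_mul, add_zero, sub_zero] at this
    exact this
  have h1 := le_of_hasDerivAt_nonneg_of_tendsto_atBot
    (fun x hx => h.hasDerivAt_pohozaev_sub hp (lt_trans hx hcb) k)
    (fun x hx => h.deriv_pohozaev_sub_nonneg hp (lt_trans hx hcb) ?_) hlim ht
  · have h2 := h.neg_four_le_slope hp hX (ht.trans hcb)
    have hk0 : 0 ≤ k := by positivity
    nlinarith
  · have h3 : p - (1 / 4 + 4 * K) ≤ p * m x := by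
      rcases le_or_gt c x with hcx | hcx
      · have := h.le_profile_after_center hp hX hm hcx (lt_trans hx hcb)
        have hx' : x < c + K := hx
        linarith
      · have := h.le_profile_center hp hX hm (lt_trans hx hcb)
        have h2 : exp (2 * (x - c)) ≤ 1 := exp_le_one_iff.2 (by linarith)
        linarith
    rw [sub_le_iff_le_add, ← sub_le_iff_le_add', le_div_iff₀ hp0]
    linarith

end Center

end EmdenSystem

lemma tendsto_time_div {ι : Type*} {L : Filter ι} {p T B μ : ι → ℝ} {b : ℝ}
    (hp : Tendsto p L atTop) (hb : 0 < b) (hB : Tendsto B L (nhds b))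
    (hμ : Tendsto μ L (nhds 1)) (hlow : ∀ᶠ n in L, p n * μ n ≤ B n * T n)
    (hup : ∀ δ, 0 < δ → δ < b → ∃ K, ∀ᶠ n in L, (b - δ) * (T n - K) ≤ p n) :
    Tendsto (fun n => T n / p n) L (nhds (1 / b)) := by
  refine tendsto_order.2 ⟨fun x hx => ?_, fun x hx => ?_⟩
  · filter_upwards [(hμ.div hB hb.ne').eventually (lt_mem_nhds hx), hlow,
      hB.eventually (lt_mem_nhds hb), hp.eventually_gt_atTop 0] with n h1 h2 h3 h4
    refine h1.trans_le ?_
    simp only [Pi.div_apply]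
    rw [div_le_div_iff₀ h3 h4]
    linarith
  · have hx0 : 0 < x := (one_div_pos.2 hb).trans hx
    have hxb : 1 / x < b := (one_div_lt hb hx0).1 hx
    have hx1 : 0 < 1 / x := one_div_pos.2 hx0
    obtain ⟨K, hK⟩ := hup ((b - 1 / x) / 2) (by linarith) (by linarith)
    set b' := b - (b - 1 / x) / 2 with hb'
    have hb'0 : 0 < b' := by linarith
    have hb'x : 1 / b' < x := (one_div_lt hx0 hb'0).1 (by linarith)
    have hlim : Tendsto (fun n => K / p n + 1 / b') L (nhds (1 / b')) := by
      simpa using (hp.const_div_atTop K).add_const (1 / b')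
    filter_upwards [hlim.eventually (gt_mem_nhds hb'x), hK, hp.eventually_gt_atTop 0]
      with n h1 h2 h3
    refine lt_of_le_of_lt ?_ h1
    rw [div_le_iff₀ h3, add_mul, div_mul_cancel₀ _ h3.ne', ← sub_le_iff_le_add', one_div_mul_eq_div,
      le_div_iff₀ hb'0]
    linarith

lemma tendsto_div_add_one {ι : Type*} {L : Filter ι} {p : ι → ℝ} (hp : Tendsto p L atTop) :
    Tendsto (fun n => p n / (p n + 1)) L (nhds 1) := by
  have h : Tendsto (fun n => 1 - 1 / (p n + 1)) L (nhds (1 - 0)) :=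
    tendsto_const_nhds.sub ((tendsto_atTop_add_const_right L 1 hp).const_div_atTop 1)
  rw [sub_zero] at h
  refine h.congr' ?_
  filter_upwards [hp.eventually_gt_atTop 0] with n hn
  field_simp
  ring

namespace EmdenSystem

variable {ι : Type*} {L : Filter ι} {p c a s b : ι → ℝ} {S : ι → Set ℝ} {m X : ι → ℝ → ℝ}

lemma tendsto_time_right (hp1 : ∀ n, 1 < p n) (hp : Tendsto p L atTop)
    (h : ∀ n, EmdenSystem (p n) (c n) (S n) (m n) (X n)) (hsb : ∀ n, s n ≤ b n)
    (hS : ∀ n, Ico (s n) (b n) ⊆ S n) (hX : ∀ n, X n (s n) = 0) (hm : ∀ n, m n (s n) = 1)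
    (hmc : ∀ n, ContinuousOn (m n) (Icc (s n) (b n))) (hmb : ∀ n, m n (b n) = 0) {l : ℝ}
    (hl : 0 < l) (hlim : Tendsto (fun n => exp (2 * (s n - c n))) L (nhds (l ^ 2))) :
    Tendsto (fun n => (b n - s n) / p n) L (nhds (1 / (√(2 * l ^ 2 + 4) + 2))) := by
  set α := √(2 * l ^ 2 + 4) with hα
  have hα2 : α ^ 2 = 2 * l ^ 2 + 4 := sq_sqrt (by positivity)
  have hαpos : 0 ≤ α := sqrt_nonneg _
  have hαgt : 2 < α := by nlinarith [pow_pos hl 2]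
  set B : ι → ℝ := fun n => √(4 + 2 * exp (2 * (s n - c n))) + 2 with hBdef
  have hB : Tendsto B L (nhds (α + 2)) := by
    rw [hα, add_comm (2 * l ^ 2)]
    exact ((hlim.const_mul 2).const_add 4).sqrt.add_const 2
  refine tendsto_time_div (B := B) (μ := fun _ => 1) hp (by linarith) hB tendsto_const_nhds
    (Eventually.of_forall fun n => ?_) fun δ hδ _ => ?_
  · rw [mul_one]
    exact (h n).le_time_max (hp1 n) (hsb n) (hS n) (hX n) (hm n) (hmc n) (hmb n)
  · set K := (α + 2) / (δ * (α - 2) / 4) with hKdef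
    have hgap : 0 < δ * (α - 2) / 4 := by
      have := mul_pos hδ (sub_pos.2 hαgt)
      linarith
    have hK0 : 0 ≤ K := div_nonneg (by linarith) hgap.le
    refine ⟨K, ?_⟩
    have hQ : Tendsto (fun n => p n / (p n + 1) * exp (2 * (s n - c n))
        - 2 * ((B n * K + 1) / p n) * B n) L (nhds ((α ^ 2 - 4) / 2)) := by
      have := ((tendsto_div_add_one hp).mul hlim).sub
        (((((hB.mul_const K).add_const 1).div_atTop hp).const_mul 2).mul hB)
      convert this using 2
      rw [hα2]
      ring
    filter_upwards [hQ.eventually (lt_mem_nhds (sub_lt_self ((α ^ 2 - 4) / 2) hgap)),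
      ((hB.mul_const K).div_atTop hp).eventually (gt_mem_nhds one_pos)] with n h1 h2
    have hp0 : 0 < p n := by linarith [hp1 n]
    have hBpos : 0 < B n := by positivity
    rw [div_lt_one hp0] at h2
    have h3 := (h n).le_time_max (hp1 n) (hsb n) (hS n) (hX n) (hm n) (hmc n) (hmb n)
    have hKb : s n + K < b n := by
      have := lt_of_mul_lt_mul_left (h2.trans_le h3) hBpos.le
      linarith
    refine (h n).time_le (hp1 n) hK0 hKb (hS n) (hmc n) (hmb n) ?_
    have h4 := (h n).slope_le_of_pohozaev (hp1 n) (t₀ := s n) (K := K) (a := α) (g := α - 2)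
      (δ := δ) (η := δ * (α - 2) / 4) hK0
      (fun x hx => hS n ⟨hx.1, hx.2.trans_lt hKb⟩) (by linarith) hδ (hX n).le
      (by rw [hX n]; linarith)
      (fun t ht => h1.le.trans ((h n).le_pohozaev_max (hp1 n) (hS n) (hX n) (hm n) (hmc n) hKb ht))
      le_rfl (by rw [hKdef, div_mul_cancel₀ _ hgap.ne'])
    linarith

lemma tendsto_slope_left (hp1 : ∀ n, 1 < p n) (hp : Tendsto p L atTop)
    (h : ∀ n, EmdenSystem (p n) (c n) (S n) (m n) (X n)) (has : ∀ n, a n ≤ s n)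
    (hS : ∀ n, Ioc (a n) (s n) ⊆ S n) (hX : ∀ n, X n (s n) = 0) (hm : ∀ n, m n (s n) = 1)
    (hmc : ∀ n, ContinuousOn (m n) (Icc (a n) (s n)))
    (hXc : ∀ n, ContinuousOn (X n) (Icc (a n) (s n))) (hma : ∀ n, m n (a n) = 0) {l : ℝ}
    (hlim : Tendsto (fun n => exp (2 * (s n - c n))) L (nhds (l ^ 2))) :
    Tendsto (fun n => X n (a n)) L (nhds (√(2 * l ^ 2 + 4) - 2)) := by
  have h1 : Tendsto (fun n => X n (a n) ^ 2 / 2 + 2 * X n (a n)) L (nhds (l ^ 2)) := by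
    refine tendsto_of_tendsto_of_tendsto_of_le_of_le
      (by simpa using (tendsto_div_add_one hp).mul hlim) hlim (fun n => ?_) (fun n => ?_)
    · exact (h n).pohozaev_left (hp1 n) (has n) (hS n) (hmc n) (hXc n) (hX n) (hm n) (hma n)
    · exact (h n).liouvilleEnergy_left (hp1 n) (has n) (hS n) (hmc n) (hXc n) (hX n) (hm n)
        (hma n)
  refine (((h1.const_mul 2).add_const 4).sqrt.sub_const 2).congr fun n => ?_
  have h2 := (h n).slope_left_nonneg (has n) (hS n) (hXc n) (hX n)
  rw [show 2 * (X n (a n) ^ 2 / 2 + 2 * X n (a n)) + 4 = (X n (a n) + 2) ^ 2 by ring,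
    sqrt_sq (by linarith)]
  ring

lemma tendsto_time_left (hp1 : ∀ n, 1 < p n) (hp : Tendsto p L atTop)
    (h : ∀ n, EmdenSystem (p n) (c n) (S n) (m n) (X n)) (has : ∀ n, a n ≤ s n)
    (hS : ∀ n, Ioc (a n) (s n) ⊆ S n) (hX : ∀ n, X n (s n) = 0) (hm : ∀ n, m n (s n) = 1)
    (hmc : ∀ n, ContinuousOn (m n) (Icc (a n) (s n)))
    (hXc : ∀ n, ContinuousOn (X n) (Icc (a n) (s n))) (hma : ∀ n, m n (a n) = 0) {l : ℝ}
    (hl : 0 < l) (hlim : Tendsto (fun n => exp (2 * (s n - c n))) L (nhds (l ^ 2))) :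
    Tendsto (fun n => (s n - a n) / p n) L (nhds (1 / (√(2 * l ^ 2 + 4) - 2))) := by
  have hX0 := tendsto_slope_left hp1 hp h has hS hX hm hmc hXc hma hlim
  have hα2 : √(2 * l ^ 2 + 4) ^ 2 = 2 * l ^ 2 + 4 := sq_sqrt (by positivity)
  have hα : 0 < √(2 * l ^ 2 + 4) - 2 := by
    nlinarith [pow_pos hl 2, sqrt_nonneg (2 * l ^ 2 + 4)]
  have h1 : Tendsto (fun n => X n (a n) * (s n - a n) / p n) L (nhds 1) := by
    have h2 : Tendsto (fun n => 1 + exp (2 * (s n - c n)) / 4 / p n) L (nhds 1) := by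
      simpa using ((hlim.div_const 4).div_atTop hp).const_add 1
    refine tendsto_of_tendsto_of_tendsto_of_le_of_le tendsto_const_nhds h2
      (fun n => ?_) (fun n => ?_)
    · have hp0 : 0 < p n := by linarith [hp1 n]
      simp only
      rw [le_div_iff₀ hp0, one_mul]
      exact (h n).le_time_left (hp1 n) (has n) (hS n) (hmc n) (hXc n) (hm n) (hma n)
    · have hp0 : 0 < p n := by linarith [hp1 n]
      simp only
      rw [div_le_iff₀ hp0, add_mul, one_mul, div_mul_cancel₀ _ hp0.ne']
      exact (h n).time_left_le (hp1 n) (has n) (hS n) (hmc n) (hXc n) (hm n) (hma n)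
  refine (h1.div hX0 hα.ne').congr' ?_
  filter_upwards [hX0.eventually (lt_mem_nhds hα)] with n hn
  simp only [Pi.div_apply]
  field_simp

lemma eventually_slope_center_le (hp1 : ∀ n, 1 < p n) (hp : Tendsto p L atTop)
    (h : ∀ n, EmdenSystem (p n) (c n) (Iio (b n)) (m n) (X n))
    (hX : ∀ n, Tendsto (X n) atBot (nhds 0)) (hm : ∀ n, Tendsto (m n) atBot (nhds 1))
    (hmc : ∀ n, ContinuousAt (m n) (b n)) (hmb : ∀ n, m n (b n) = 0) {δ : ℝ} (hδ : 0 < δ) :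
    ∃ K, 0 ≤ K ∧ ∀ᶠ n in L, c n + K < b n ∧ X n (c n + K) ≤ -4 + δ := by
  set K := 4 / (δ * (3 / 8) / 4) with hKdef
  have hK0 : 0 ≤ K := by positivity
  refine ⟨K, hK0, ?_⟩
  have hQ : Tendsto (fun n => 8 * ((1 / 4 + 4 * (K + 1)) / p n + 1 / p n)) L (nhds 0) := by
    simpa using ((hp.const_div_atTop (1 / 4 + 4 * (K + 1))).add
      (hp.const_div_atTop 1)).const_mul 8
  filter_upwards [hQ.eventually (gt_mem_nhds (show 0 < δ * (3 / 8) / 4 by positivity)),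
    hp.eventually_ge_atTop (exp (2 * (K + 1)))] with n h1 h2
  have hcb : c n + (K + 1) < b n := by
    have h3 := (h n).le_exp_center (hp1 n) (hX n) (hm n) (hmc n) (hmb n)
    have h4 : exp (2 * (K + 1)) < exp (2 * (b n - c n)) := by linarith [hp1 n]
    have := exp_lt_exp.1 h4
    linarith
  have hX0 := (h n).slope_center_le (hp1 n) (hX n) (hm n) (by linarith)
  refine ⟨by linarith, ?_⟩
  have h4 := (h n).slope_le_of_pohozaev (hp1 n) (t₀ := c n) (K := K) (a := 2) (g := 3 / 8)
      (δ := δ) (η := δ * (3 / 8) / 4) hK0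
      (fun x hx => by
        have := hx.2
        simp only [mem_Iio]
        linarith) (by norm_num) hδ (by linarith) (by linarith)
      (fun t ht => by
        have := (h n).le_pohozaev_center (hp1 n) (hX n) (hm n) (K := K + 1) (t := t)
          (by linarith) hcb (by linarith [ht.2])
        linarith)
      le_rfl (by rw [hKdef, div_mul_cancel₀ _ (by positivity)]; norm_num)
  linarith

lemma tendsto_time_center (hp1 : ∀ n, 1 < p n) (hp : Tendsto p L atTop)
    (h : ∀ n, EmdenSystem (p n) (c n) (Iio (b n)) (m n) (X n))
    (hX : ∀ n, Tendsto (X n) atBot (nhds 0)) (hm : ∀ n, Tendsto (m n) atBot (nhds 1))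
    (hmc : ∀ n, ContinuousAt (m n) (b n)) (hmb : ∀ n, m n (b n) = 0) :
    Tendsto (fun n => (b n - c n) / p n) L (nhds (1 / 4)) := by
  have hcont : ∀ n, ContinuousOn (m n) (Iic (b n)) := by
    intro n t ht
    rcases eq_or_lt_of_le (show t ≤ b n from ht) with rfl | htb
    · exact (hmc n).continuousWithinAt
    · exact ((h n).deriv_m t htb).continuousAt.continuousWithinAt
  have hμ : Tendsto (fun n => 1 - 1 / 4 / p n) L (nhds 1) := by
    simpa using (hp.const_div_atTop (1 / 4)).const_sub 1
  refine tendsto_time_div (B := fun _ => 4) hp four_pos tendsto_const_nhds hμ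
    (Eventually.of_forall fun n => ?_) fun δ hδ _ => ?_
  · have hp0 : 0 < p n := by linarith [hp1 n]
    have hcb : c n < b n := by
      have h3 := (h n).le_exp_center (hp1 n) (hX n) (hm n) (hmc n) (hmb n)
      have h4 : exp 0 < exp (2 * (b n - c n)) := by rw [exp_zero]; linarith [hp1 n]
      have := exp_lt_exp.1 h4
      linarith
    have h1 := (h n).le_profile_center (hp1 n) (hX n) (hm n) hcb
    have h2 := (h n).le_profile (hp1 n) hcb.le Ioo_subset_Iio_self
      ((hcont n).mono Icc_subset_Iic_self) (k := -4)
      (fun x hx => (h n).neg_four_le_slope (hp1 n) (hX n) hx.2)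
    rw [hmb n] at h2
    rw [sub_self, mul_zero, exp_zero] at h1
    rw [mul_sub, mul_div_cancel₀ _ hp0.ne']
    linarith
  · obtain ⟨K, hK0, hK⟩ := eventually_slope_center_le hp1 hp h hX hm hmc hmb hδ
    refine ⟨K, ?_⟩
    filter_upwards [hK] with n hn
    exact (h n).time_le (hp1 n) hK0 hn.1 Ico_subset_Iio_self
      ((hcont n).mono Icc_subset_Iic_self) (hmb n) (by linarith [hn.2])

lemma tendsto_slope_center (hp1 : ∀ n, 1 < p n) (hp : Tendsto p L atTop)
    (h : ∀ n, EmdenSystem (p n) (c n) (Iio (b n)) (m n) (X n))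
    (hX : ∀ n, Tendsto (X n) atBot (nhds 0)) (hm : ∀ n, Tendsto (m n) atBot (nhds 1))
    (hmc : ∀ n, ContinuousAt (m n) (b n)) (hXc : ∀ n, ContinuousAt (X n) (b n))
    (hmb : ∀ n, m n (b n) = 0) :
    Tendsto (fun n => X n (b n)) L (nhds (-4)) := by
  refine tendsto_order.2 ⟨fun x hx => Eventually.of_forall fun n => hx.trans_le ?_, fun x hx => ?_⟩
  · refine ge_of_tendsto ((hXc n).tendsto.mono_left nhdsWithin_le_nhds :
      Tendsto _ (nhdsWithin (b n) (Iio (b n))) _) ?_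
    filter_upwards [self_mem_nhdsWithin] with t ht using (h n).neg_four_le_slope (hp1 n) (hX n) ht
  · obtain ⟨K, _, hK⟩ := eventually_slope_center_le hp1 hp h hX hm hmc hmb
      (δ := (x + 4) / 2) (by linarith)
    filter_upwards [hK] with n hn
    have hcont : ContinuousOn (X n) (Icc (c n + K) (b n)) := by
      intro t ht
      rcases eq_or_lt_of_le ht.2 with rfl | htb
      · exact (hXc n).continuousWithinAt
      · exact ((h n).deriv_X t htb).continuousAt.continuousWithinAt
    have := (h n).antitone_slope hn.1.le Ioo_subset_Iio_self hcont
    linarith [hn.2]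

end EmdenSystem

/-- The normalized profile `u / M` in the variable `t = log r`. -/
def logProfile (M : ℝ) (v : ℝ → ℝ) (t : ℝ) : ℝ := v (exp t) / M

/-- The scaled slope `p r u' / M` in the variable `t = log r`. -/
def logSlope (p M : ℝ) (v : ℝ → ℝ) (t : ℝ) : ℝ := p * (exp t * deriv v (exp t)) / M

/-- The logarithm of the concentration scale `(p M ^ (p - 1)) ^ (-1 / 2)`. -/
def logScale (p M : ℝ) : ℝ := -(log (p * M ^ (p - 1)) / 2)

lemma exp_mem_Ioo {t : ℝ} (ht : t < 0) : exp t ∈ Ioo (0 : ℝ) 1 := ⟨exp_pos t, by simpa using ht⟩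

section Profile

variable {p M : ℝ} {v : ℝ → ℝ}

lemma hasDerivAt_of_contDiffOn (hv : ContDiffOn ℝ 2 v (Icc 0 1)) {r : ℝ} (hr : r ∈ Ioo (0 : ℝ) 1) :
    HasDerivAt v (deriv v r) r ∧ HasDerivAt (deriv v) (deriv (deriv v) r) r := by
  have h1 : ContDiffAt ℝ 2 v r := hv.contDiffAt (Icc_mem_nhds hr.1 hr.2)
  have h2 : ContDiffAt ℝ 1 (deriv v) r := by
    have h3 : ContDiffOn ℝ 1 (deriv v) (Ioo 0 1) :=
      ((contDiffOn_succ_iff_deriv_of_isOpen (n := 1) isOpen_Ioo).1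
        (by norm_num; exact hv.mono Ioo_subset_Icc_self)).2.2
    exact h3.contDiffAt (Ioo_mem_nhds hr.1 hr.2)
  exact ⟨(h1.differentiableAt (by norm_num)).hasDerivAt,
    (h2.differentiableAt (by norm_num)).hasDerivAt⟩

lemma hasDerivAt_logProfile (hp : p ≠ 0) (hv : ContDiffOn ℝ 2 v (Icc 0 1)) {t : ℝ} (ht : t < 0) :
    HasDerivAt (logProfile M v) (logSlope p M v t / p) t := by
  refine (((hasDerivAt_of_contDiffOn hv (exp_mem_Ioo ht)).1.comp t
    (hasDerivAt_exp t)).div_const M).congr_deriv ?_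
  unfold logSlope
  field_simp

lemma hasDerivAt_logSlope (hv : ContDiffOn ℝ 2 v (Icc 0 1)) {t : ℝ} (ht : t < 0) :
    HasDerivAt (logSlope p M v)
      (p * (exp t * deriv v (exp t) + exp t * (deriv (deriv v) (exp t) * exp t)) / M) t :=
  (((hasDerivAt_exp t).mul ((hasDerivAt_of_contDiffOn hv (exp_mem_Ioo ht)).2.comp t
    (hasDerivAt_exp t))).const_mul p).div_const M

lemma emdenSystem_of_ode {S : Set ℝ} (hp : 1 < p) (hM : 0 < M) (hv : ContDiffOn ℝ 2 v (Icc 0 1))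
    (hode : ∀ r ∈ Ioo (0 : ℝ) 1, -deriv (deriv v) r - deriv v r / r = |v r| ^ (p - 1) * v r)
    (hS : S ⊆ Iio 0) (hpos : ∀ t ∈ S, 0 < v (exp t)) (hle : ∀ t ∈ S, v (exp t) ≤ M) :
    EmdenSystem p (logScale p M) S (logProfile M v) (logSlope p M v) where
  deriv_m t ht := hasDerivAt_logProfile (by linarith) hv (hS ht)
  deriv_X t ht := by
    have hp0 : 0 < p := by linarith
    refine (hasDerivAt_logSlope hv (hS ht)).congr_deriv ?_
    have h1 := hode _ (exp_mem_Ioo (hS ht))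
    have h2 := hpos t ht
    have h3 : deriv (deriv v) (exp t) = -(v (exp t) ^ p) - deriv v (exp t) / exp t := by
      rw [abs_of_pos h2, rpow_sub_one h2.ne', div_mul_cancel₀ _ h2.ne'] at h1
      linarith
    have h4 : exp (2 * (t - logScale p M)) = exp t ^ 2 * (p * (M ^ p / M)) := by
      rw [show 2 * (t - logScale p M) = t + t + log (p * M ^ (p - 1)) by unfold logScale; ring,
        exp_add, exp_add, exp_log (by positivity), rpow_sub_one hM.ne']
      ring
    rw [h4, h3, logProfile, div_rpow h2.le hM.le]
    have := (rpow_pos_of_pos hM p).ne'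
    have := (exp_pos t).ne'
    field_simp
    ring
  pos t ht := div_pos (hpos t ht) hM
  le_one t ht := (div_le_one hM).2 (hle t ht)

lemma continuousOn_logProfile (hv : ContDiffOn ℝ 2 v (Icc 0 1)) :
    ContinuousOn (logProfile M v) (Iic 0) :=
  (hv.continuousOn.comp continuous_exp.continuousOn
    fun t ht => ⟨(exp_pos t).le, exp_le_one_iff.2 ht⟩).div_const M

lemma tendsto_exp_atBot_nhdsWithin : Tendsto exp atBot (nhdsWithin 0 (Icc 0 1)) := by
  refine tendsto_nhdsWithin_iff.2 ⟨Real.tendsto_exp_atBot, ?_⟩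
  filter_upwards [eventually_le_atBot 0] with t ht using ⟨(exp_pos t).le, exp_le_one_iff.2 ht⟩

lemma tendsto_logProfile (hv : ContDiffOn ℝ 2 v (Icc 0 1)) (h0 : v 0 = M) (hM : M ≠ 0) :
    Tendsto (logProfile M v) atBot (nhds 1) := by
  have h := ((hv.continuousOn 0 (by simp)).tendsto.comp tendsto_exp_atBot_nhdsWithin).div_const M
  rwa [h0, div_self hM] at h

lemma tendsto_logSlope (hv : ContDiffOn ℝ 2 v (Icc 0 1)) :
    Tendsto (logSlope p M v) atBot (nhds 0) := by
  have h1 : ContinuousOn (derivWithin v (Icc 0 1)) (Icc 0 1) :=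
    hv.continuousOn_derivWithin (uniqueDiffOn_Icc one_pos) (by norm_num)
  have h2 := ((Real.tendsto_exp_atBot.mul ((h1 0 (by simp)).tendsto.comp
    tendsto_exp_atBot_nhdsWithin)).const_mul p).div_const M
  simp only [zero_mul, mul_zero, zero_div] at h2
  refine h2.congr' ?_
  filter_upwards [eventually_lt_atBot 0] with t ht
  have hr := exp_mem_Ioo ht
  simp only [logSlope, Function.comp_apply, derivWithin_of_mem_nhds (Icc_mem_nhds hr.1 hr.2)]

end Profile

lemma tendsto_log_max {ι : Type*} {L : Filter ι} {p M x : ι → ℝ} {τ ξ : ℝ}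
    (hp1 : ∀ n, 1 < p n) (hp : Tendsto p L atTop) (hM : ∀ n, 0 < M n)
    (hτ : Tendsto (fun n => (x n - logScale (p n) (M n)) / p n) L (nhds τ))
    (hξ : Tendsto (fun n => 2 / (p n - 1) * x n) L (nhds ξ)) :
    Tendsto (fun n => log (M n)) L (nhds (2 * τ - ξ)) := by
  have h1 : Tendsto (fun n => p n / (p n - 1)) L (nhds 1) := by
    have h : Tendsto (fun n => 1 + 1 / (p n - 1)) L (nhds (1 + 0)) :=
      ((tendsto_atTop_add_const_right L (-1) hp).const_div_atTop 1).const_add 1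
    rw [add_zero] at h
    refine h.congr fun n => ?_
    have : p n - 1 ≠ 0 := by linarith [hp1 n]
    field_simp
    ring
  have h2 : Tendsto (fun n => log (p n) / p n) L (nhds 0) :=
    isLittleO_log_id_atTop.tendsto_div_nhds_zero.comp hp
  have h3 := (h1.mul ((hτ.const_mul 2).sub h2)).sub hξ
  rw [sub_zero, one_mul] at h3
  refine h3.congr fun n => ?_
  have hp0 : 0 < p n := by linarith [hp1 n]
  have hp2 : p n - 1 ≠ 0 := by linarith [hp1 n]
  rw [logScale, log_mul hp0.ne' (rpow_pos_of_pos (hM n) _).ne', log_rpow (hM n)]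
  field_simp
  ring

namespace LaneEmdenFamily

variable (F : LaneEmdenFamily) {p : ℝ}

lemma sp_pos (hp : 1 < p) : 0 < F.sp p := (F.rp_mem p hp).1.trans (F.sp_mem p hp).1

lemma max_pos (hp : 1 < p) : 0 < F.u p (F.sp p) := F.pos_out p hp _ (F.sp_mem p hp)

lemma log_rp_neg (hp : 1 < p) : log (F.rp p) < 0 :=
  log_neg (F.rp_mem p hp).1 (F.rp_mem p hp).2

lemma log_rp_lt_log_sp (hp : 1 < p) : log (F.rp p) < log (F.sp p) :=
  log_lt_log (F.rp_mem p hp).1 (F.sp_mem p hp).1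

lemma log_sp_neg (hp : 1 < p) : log (F.sp p) < 0 :=
  log_neg (F.sp_pos hp) (F.sp_mem p hp).2

lemma exp_mem_outer (hp : 1 < p) {t : ℝ} (ht : t ∈ Ioo (log (F.rp p)) 0) :
    exp t ∈ Ioo (F.rp p) 1 :=
  ⟨(log_lt_iff_lt_exp (F.rp_mem p hp).1).1 ht.1, (exp_mem_Ioo ht.2).2⟩

lemma outerSystem (hp : 1 < p) :
    EmdenSystem p (logScale p (F.u p (F.sp p))) (Ioo (log (F.rp p)) 0)
      (logProfile (F.u p (F.sp p)) (F.u p)) (logSlope p (F.u p (F.sp p)) (F.u p)) :=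
  emdenSystem_of_ode hp (F.max_pos hp) (F.smooth p hp) (F.ode p hp) Ioo_subset_Iio_self
    (fun _ ht => F.pos_out p hp _ (F.exp_mem_outer hp ht))
    (fun _ ht => F.sp_max p hp _ (Ioo_subset_Icc_self (exp_mem_Ioo ht.2)))

lemma contDiffOn_neg (hp : 1 < p) : ContDiffOn ℝ 2 (fun r => -F.u p r) (Icc 0 1) :=
  (F.smooth p hp).neg

lemma innerSystem (hp : 1 < p) :
    EmdenSystem p (logScale p (-F.u p 0)) (Iio (log (F.rp p)))
      (logProfile (-F.u p 0) fun r => -F.u p r) (logSlope p (-F.u p 0) fun r => -F.u p r) := by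
  have hlt : ∀ t ∈ Iio (log (F.rp p)), t < 0 := fun t ht => lt_trans ht (F.log_rp_neg hp)
  refine emdenSystem_of_ode hp (neg_pos.2 (F.center_neg p hp)) (F.contDiffOn_neg hp)
    (fun r hr => ?_) hlt (fun t ht => neg_pos.2 (F.neg_in p hp _ ⟨(exp_pos t).le, ?_⟩))
    (fun t ht => neg_le_neg (F.min_at_zero p hp _ (Ioo_subset_Icc_self (exp_mem_Ioo (hlt t ht)))))
  · have h := F.ode p hp r hr
    simp only [deriv.fun_neg', deriv.fun_neg, abs_neg]
    linear_combination -h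
  · exact (lt_log_iff_exp_lt (F.rp_mem p hp).1).1 ht

lemma deriv_sp (hp : 1 < p) : deriv (F.u p) (F.sp p) = 0 := by
  refine IsLocalMax.deriv_eq_zero ?_
  filter_upwards [Icc_mem_nhds (F.sp_pos hp) (F.sp_mem p hp).2] with r hr using F.sp_max p hp r hr

lemma exp_two_mul_log_sp_sub (hp : 1 < p) :
    exp (2 * (log (F.sp p) - logScale p (F.u p (F.sp p)))) = (F.sp p / epsP F p) ^ 2 := by
  have hM := F.max_pos hp
  have hp0 : 0 < p := by linarith
  have hs := F.sp_pos hp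
  rw [show 2 * (log (F.sp p) - logScale p (F.u p (F.sp p)))
      = log (F.sp p) + log (F.sp p) + log (p * F.u p (F.sp p) ^ (p - 1)) by unfold logScale; ring,
    exp_add, exp_add, exp_log hs, exp_log (by positivity), epsP, div_div_eq_mul_div, div_one,
    mul_pow, sq_sqrt (by positivity)]
  ring

end LaneEmdenFamily

/-- Under the stated limit assumptions, `u_∞ = e^{2/(α+2)}`; moreover `α = 2 + 4√e/t̄`, where `t̄` is the unique positive root of `2√e·log t + t = 0`. -/
theorem uinf_value (F : LaneEmdenFamily) (pn : ℕ → ℝ) (hpn : ∀ n, 1 < pn n)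
    (hto : Tendsto pn atTop atTop) (l rinf uinf : ℝ)
    (hl : 0 < l) (hrinf : 0 < rinf) (hrinf1 : rinf ≤ 1) (huinf : 0 < uinf)
    (hlimL : Tendsto (fun n => F.sp (pn n) / epsP F (pn n)) atTop (nhds l))
    (hlimR : Tendsto (fun n => F.rp (pn n) ^ (2 / (pn n - 1))) atTop (nhds rinf))
    (hlimU : Tendsto (fun n => F.u (pn n) (F.sp (pn n))) atTop (nhds uinf)) :
    uinf = Real.exp (2 / (alphaOf l + 2)) ∧
    (∃! t : ℝ, 0 < t ∧ 2 * Real.sqrt (Real.exp 1) * Real.log t + t = 0) ∧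
    ∀ t : ℝ, 0 < t → 2 * Real.sqrt (Real.exp 1) * Real.log t + t = 0 →
      alphaOf l = 2 + 4 * Real.sqrt (Real.exp 1) / t := by
  set α := alphaOf l with hα
  have hαdef : √(2 * l ^ 2 + 4) = α := rfl
  have hα2 : α ^ 2 = 2 * l ^ 2 + 4 := sq_sqrt (by positivity)
  have hαgt : 2 < α := by nlinarith [pow_pos hl 2, sqrt_nonneg (2 * l ^ 2 + 4)]
  have hM := fun n => F.max_pos (hpn n)
  have hM0 := fun n => neg_pos.2 (F.center_neg _ (hpn n))
  have htr := fun n => F.log_rp_neg (hpn n)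
  have hts := fun n => F.log_sp_neg (hpn n)
  have hrs := fun n => F.log_rp_lt_log_sp (hpn n)
  have hlam : Tendsto (fun n => exp (2 * (log (F.sp (pn n))
      - logScale (pn n) (F.u (pn n) (F.sp (pn n)))))) atTop (nhds (l ^ 2)) :=
    (hlimL.pow 2).congr fun n => (F.exp_two_mul_log_sp_sub (hpn n)).symm
  have hX : ∀ n, logSlope (pn n) (F.u (pn n) (F.sp (pn n))) (F.u (pn n)) (log (F.sp (pn n))) = 0 :=
    fun n => by simp [logSlope, exp_log (F.sp_pos (hpn n)), F.deriv_sp (hpn n)]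
  have hm : ∀ n, logProfile (F.u (pn n) (F.sp (pn n))) (F.u (pn n)) (log (F.sp (pn n))) = 1 :=
    fun n => by rw [logProfile, exp_log (F.sp_pos (hpn n)), div_self (hM n).ne']
  have hm1 : ∀ n, logProfile (F.u (pn n) (F.sp (pn n))) (F.u (pn n)) 0 = 0 :=
    fun n => by simp [logProfile, F.boundary _ (hpn n)]
  have hmr : ∀ n, logProfile (F.u (pn n) (F.sp (pn n))) (F.u (pn n)) (log (F.rp (pn n))) = 0 :=
    fun n => by simp [logProfile, exp_log (F.rp_mem _ (hpn n)).1, F.rp_zero _ (hpn n)]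
  have hmc := fun n => continuousOn_logProfile (M := F.u (pn n) (F.sp (pn n))) (F.smooth _ (hpn n))
  have hmcl : ∀ n, ContinuousOn (logProfile (F.u (pn n) (F.sp (pn n))) (F.u (pn n)))
      (Icc (log (F.rp (pn n))) (log (F.sp (pn n)))) :=
    fun n => (hmc n).mono fun t ht => ht.2.trans (hts n).le
  have hXcl : ∀ n, ContinuousOn (logSlope (pn n) (F.u (pn n) (F.sp (pn n))) (F.u (pn n)))
      (Icc (log (F.rp (pn n))) (log (F.sp (pn n)))) := fun n t ht =>
    (hasDerivAt_logSlope (F.smooth _ (hpn n))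
      (ht.2.trans_lt (hts n))).continuousAt.continuousWithinAt
  have hSl : ∀ n, Ioc (log (F.rp (pn n))) (log (F.sp (pn n))) ⊆ Ioo (log (F.rp (pn n))) 0 :=
    fun n t ht => ⟨ht.1, ht.2.trans_lt (hts n)⟩
  have hright := EmdenSystem.tendsto_time_right (b := fun _ => 0) hpn hto
    (fun n => F.outerSystem (hpn n)) (fun n => (hts n).le)
    (fun n t ht => ⟨(hrs n).trans_le ht.1, ht.2⟩) hX hm
    (fun n => (hmc n).mono fun t ht => ht.2) hm1 hl hlam
  have hleft := EmdenSystem.tendsto_time_left hpn hto (fun n => F.outerSystem (hpn n))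
    (fun n => (hrs n).le) hSl hX hm hmcl hXcl hmr hl hlam
  have hXl := EmdenSystem.tendsto_slope_left hpn hto (fun n => F.outerSystem (hpn n))
    (fun n => (hrs n).le) hSl hX hm hmcl hXcl hmr hlam
  rw [hαdef] at hright hleft hXl
  have hXin : ∀ n, Tendsto (logSlope (pn n) (-F.u (pn n) 0) fun r => -F.u (pn n) r)
      atBot (nhds 0) := fun n => tendsto_logSlope (F.contDiffOn_neg (hpn n))
  have hmin : ∀ n, Tendsto (logProfile (-F.u (pn n) 0) fun r => -F.u (pn n) r)
      atBot (nhds 1) := fun n => tendsto_logProfile (F.contDiffOn_neg (hpn n)) rfl (hM0 n).ne'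
  have hminc : ∀ n, ContinuousAt (logProfile (-F.u (pn n) 0) fun r => -F.u (pn n) r)
      (log (F.rp (pn n))) := fun n =>
    (hasDerivAt_logProfile (p := pn n) (by linarith [hpn n]) (F.contDiffOn_neg (hpn n))
      (htr n)).continuousAt
  have hXinc : ∀ n, ContinuousAt (logSlope (pn n) (-F.u (pn n) 0) fun r => -F.u (pn n) r)
      (log (F.rp (pn n))) := fun n =>
    (hasDerivAt_logSlope (F.contDiffOn_neg (hpn n)) (htr n)).continuousAt
  have hminr : ∀ n, logProfile (-F.u (pn n) 0) (fun r => -F.u (pn n) r) (log (F.rp (pn n))) = 0 :=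
    fun n => by simp [logProfile, exp_log (F.rp_mem _ (hpn n)).1, F.rp_zero _ (hpn n)]
  have hcenter := EmdenSystem.tendsto_time_center hpn hto (fun n => F.innerSystem (hpn n))
    hXin hmin hminc hminr
  have hXc := EmdenSystem.tendsto_slope_center hpn hto (fun n => F.innerSystem (hpn n))
    hXin hmin hminc hXinc hminr
  have hscale : Tendsto (fun n => (log (F.sp (pn n))
      - logScale (pn n) (F.u (pn n) (F.sp (pn n)))) / pn n) atTop (nhds 0) := by
    have h1 := (hlam.log (pow_pos hl 2).ne').div_const 2
    simp only [log_exp] at h1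
    refine (h1.div_atTop hto).congr fun n => ?_
    ring
  have hlogr : Tendsto (fun n => 2 / (pn n - 1) * log (F.rp (pn n))) atTop (nhds (log rinf)) :=
    (hlimR.log hrinf.ne').congr fun n => log_rpow (F.rp_mem _ (hpn n)).1 _
  have hlogu : log uinf = 2 / (α + 2) := by
    have h1 := tendsto_log_max (x := fun _ => 0) (τ := 1 / (α + 2)) (ξ := 0) hpn hto hM
      (by
        have := hright.add hscale
        rw [add_zero] at this
        refine this.congr fun n => ?_
        ring) (by simp)
    rw [tendsto_nhds_unique (hlimU.log huinf.ne') h1]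
    ring
  have hrinf_log : log rinf = -(2 / (α + 2) + 2 / (α - 2)) := by
    have h1 := tendsto_log_max (τ := 1 / (α + 2) - (1 / (α + 2) + 1 / (α - 2))) hpn hto hM
      (by
        have := (hright.add hscale).sub (hright.add hleft)
        rw [add_zero] at this
        refine this.congr fun n => ?_
        ring) hlogr
    have h2 := tendsto_nhds_unique (hlimU.log huinf.ne') h1
    rw [hlogu] at h2
    linear_combination h2
  have hlogM0 := tendsto_log_max hpn hto hM0 hcenter hlogr
  have hM0lim : Tendsto (fun n => -F.u (pn n) 0) atTop (nhds (exp (2 * (1 / 4) - log rinf))) :=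
    ((continuous_exp.tendsto _).comp hlogM0).congr fun n => exp_log (hM0 n)
  have huexp : uinf = exp (2 / (α + 2)) := by rw [← hlogu, exp_log huinf]
  have hmatch : (α - 2) * uinf = 4 * exp (2 * (1 / 4) - log rinf) := by
    have h1 : Tendsto (fun n => logSlope (pn n) (F.u (pn n) (F.sp (pn n))) (F.u (pn n))
        (log (F.rp (pn n))) * F.u (pn n) (F.sp (pn n))) atTop
        (nhds (- -4 * exp (2 * (1 / 4) - log rinf))) := by
      refine (hXc.neg.mul hM0lim).congr fun n => ?_
      simp only [logSlope, deriv.fun_neg]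
      rw [div_mul_cancel₀ _ (hM n).ne', neg_mul, div_mul_cancel₀ _ (hM0 n).ne']
      ring
    rw [neg_neg] at h1
    exact tendsto_nhds_unique (hXl.mul hlimU) h1
  set c := √(exp 1) with hc
  have hce : c = exp (1 / 2) := by rw [hc, sqrt_eq_rpow, ← exp_mul, one_mul]
  have hcpos : 0 < c := sqrt_pos.2 (exp_pos 1)
  have hαeq : α - 2 = 4 * c * exp (2 / (α - 2)) := by
    rw [huexp, hrinf_log] at hmatch
    have h1 : exp (2 * (1 / 4) - -(2 / (α + 2) + 2 / (α - 2)))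
        = c * exp (2 / (α - 2)) * exp (2 / (α + 2)) := by
      rw [hce, ← exp_add, ← exp_add]
      congr 1
      ring
    rw [h1] at hmatch
    refine mul_right_cancel₀ (exp_pos (2 / (α + 2))).ne' ?_
    linarith
  have hroot_pos : 0 < 4 * c / (α - 2) := div_pos (by linarith) (by linarith)
  have hroot : 2 * c * log (4 * c / (α - 2)) + 4 * c / (α - 2) = 0 := by
    have h1 : 4 * c / (α - 2) = exp (-(2 / (α - 2))) := by
      rw [div_eq_iff (by linarith), exp_neg]
      nth_rw 2 [hαeq]
      have := (exp_pos (2 / (α - 2))).ne'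
      field_simp
    have h2 : log (4 * c / (α - 2)) = -(2 / (α - 2)) := by rw [h1, log_exp]
    rw [h2]
    ring
  have huniq : ∀ t : ℝ, 0 < t → 2 * c * log t + t = 0 → t = 4 * c / (α - 2) := by
    intro t ht h
    rcases lt_trichotomy t (4 * c / (α - 2)) with h1 | h1 | h1
    · have := mul_lt_mul_of_pos_left (log_lt_log ht h1) (show 0 < 2 * c by linarith)
      linarith
    · exact h1
    · have := mul_lt_mul_of_pos_left (log_lt_log hroot_pos h1) (show 0 < 2 * c by linarith)
      linarith
  refine ⟨huexp, ⟨_, ⟨hroot_pos, hroot⟩, fun t ht => huniq t ht.1 ht.2⟩, fun t ht h => ?_⟩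
  rw [huniq t ht h]
  field_simp
  ring
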